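/- arXiv:math/0310143 — 2 statements merged into one kernel-verified Lean document; each statement's English description precedes it below -/
import Mathlib

section
/- Let n ≥ 2 be a natural number and assume v is generic. For integers 0 ≤ i < j ≤ n define a_{i,j} = [2]^{i−j+1}·[n+1]·[n−j+1]·[2n−2i+2] / ([n]·[2n+2]·[n−i+1]), where [2]^{i−j+1} denotes the (possibly negative) integer power of [2]. Then: (i) a_{0,1} = 1; (ii) a_{n−2,n−1} + ([2][6]/[3])·a_{n−2,n} − ([2][6]/[3])·a_{n−1,n} = 0; (iii) for 1 ≤ i ≤ n−3, a_{i,i+1} + ([2][6]/[3])·a_{i,i+2} − [2][4]·a_{i,i+3} − ([2][6]/[3])·a_{i+1,i+2} + ([2][6]/[3])·a_{i+1,i+3} + a_{i+2,i+3} = 0; (iv) for 0 ≤ i ≤ n−2, a_{i,n−1} = [2]²·a_{i,n}; (v) for 0 ≤ i ≤ n−3 and 2 ≤ k ≤ n−i−1, a_{i,n−k} − [2]²·a_{i,n−k+1} + [2]²·a_{i,n−k+2} = 0; (vi) for 3 ≤ i ≤ n and n−i+3 ≤ k ≤ n, [2]²·a_{n−k,i} − [2]²·a_{n−k+1,i}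 + a_{n−k+2,i} = 0. -/
/-- Quantum integer `[n] = (v^n - v^(-n))/(v - v⁻¹)`. -/
noncomputable def qint {K : Type*} [Field K] (v : K) (n : ℤ) : K :=
  (v ^ n - v ^ (-n)) / (v - v⁻¹)

/-- Quantum factorial `[n]! = [n]·[n-1]⋯[1]`, with `[0]! = 1`. -/
noncomputable def qfact {K : Type*} [Field K] (v : K) : ℕ → K
  | 0 => 1
  | n + 1 => qint v (n + 1) * qfact v n

section QuantumIntegers

variable {K : Type*} [Field K] {v : K}

/-- The symmetric sum `v^n + v^(-n)`, which equals `[2n]/[n]` when `[n] ≠ 0`. -/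
def qsum (v : K) (n : ℤ) : K := v ^ n + v ^ (-n)

theorem qint_one (hvv : v - v⁻¹ ≠ 0) : qint v 1 = 1 := by
  simp [qint, hvv]

theorem qint_two (hvv : v - v⁻¹ ≠ 0) : qint v 2 = v + v⁻¹ := by
  rw [qint, div_eq_iff hvv, zpow_neg, zpow_ofNat]
  ring

theorem qint_two_mul (hv : v ≠ 0) (m : ℤ) : qint v (2 * m) = qint v m * qsum v m := by
  have h₁ : v ^ (2 * m) = v ^ m * v ^ m := by rw [two_mul, zpow_add₀ hv]
  have h₂ : v ^ (-(2 * m)) = v ^ (-m) * v ^ (-m) := by rw [← zpow_add₀ hv]; congr 1; ring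
  rw [qint, qint, qsum, h₁, h₂]
  ring

theorem qint_add_one_add_qint_sub_one (hv : v ≠ 0) (hvv : v - v⁻¹ ≠ 0) (k : ℤ) :
    qint v (k + 1) + qint v (k - 1) = qint v 2 * qint v k := by
  rw [qint_two hvv]
  simp only [qint, neg_add, neg_sub, zpow_add₀ hv, zpow_sub₀ hv, zpow_neg, zpow_one]
  field_simp
  ring

theorem qsum_add_one_add_qsum_sub_one (hv : v ≠ 0) (hvv : v - v⁻¹ ≠ 0) (k : ℤ) :
    qsum v (k + 1) + qsum v (k - 1) = qint v 2 * qsum v k := by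
  rw [qint_two hvv]
  simp only [qsum, neg_add, neg_sub, zpow_add₀ hv, zpow_sub₀ hv, zpow_neg, zpow_one]
  field_simp
  ring

theorem qint_qsum_six_term_relation (hv : v ≠ 0) (hvv : v - v⁻¹ ≠ 0) (m : ℤ) :
    qint v (m - 1) * qsum v m + qsum v 3 * (qint v (m - 2) * qsum v m)
      - qsum v 2 * (qint v (m - 3) * qsum v m)
      - qint v 2 * qsum v 3 * (qint v (m - 2) * qsum v (m - 1))
      + qsum v 3 * (qint v (m - 3) * qsum v (m - 1))
      + qint v (m - 3) * qsum v (m - 2) = 0 := by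
  have hm : v ^ m ≠ 0 := zpow_ne_zero m hv
  rw [qint_two hvv]
  simp only [qint, qsum, neg_sub, zpow_sub₀ hv, zpow_neg, zpow_ofNat]
  generalize v ^ m = x at hm ⊢
  field_simp
  ring

end QuantumIntegers

theorem stmt10 {K : Type*} [Field K] (v : K) (hv : v ≠ 0) (hvv : v - v⁻¹ ≠ 0)
    (hgen : ∀ m : ℤ, 1 ≤ m → qint v m ≠ 0)
    (n : ℕ) (hn : 2 ≤ n)
    (A : ℕ → ℕ → K)
    (hA : ∀ i j : ℕ, i < j → j ≤ n →
      A i j = qint v 2 ^ ((i : ℤ) - j + 1) *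
        (qint v (n + 1 : ℤ) * qint v (n - j + 1 : ℤ) * qint v (2 * n - 2 * i + 2 : ℤ)) /
        (qint v n * qint v (2 * n + 2 : ℤ) * qint v (n - i + 1 : ℤ))) :
    A 0 1 = 1 ∧
    (A (n - 2) (n - 1) + (qint v 2 * qint v 6 / qint v 3) * A (n - 2) n
        - (qint v 2 * qint v 6 / qint v 3) * A (n - 1) n = 0) ∧
    (∀ i : ℕ, 1 ≤ i → i + 3 ≤ n →
      A i (i + 1) + (qint v 2 * qint v 6 / qint v 3) * A i (i + 2)
        - qint v 2 * qint v 4 * A i (i + 3)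
        - (qint v 2 * qint v 6 / qint v 3) * A (i + 1) (i + 2)
        + (qint v 2 * qint v 6 / qint v 3) * A (i + 1) (i + 3)
        + A (i + 2) (i + 3) = 0) ∧
    (∀ i : ℕ, i + 2 ≤ n → A i (n - 1) = qint v 2 ^ 2 * A i n) ∧
    (∀ i k : ℕ, i + 3 ≤ n → 2 ≤ k → k + i + 1 ≤ n →
      A i (n - k) - qint v 2 ^ 2 * A i (n - k + 1)
        + qint v 2 ^ 2 * A i (n - k + 2) = 0) ∧
    (∀ i k : ℕ, 3 ≤ i → i ≤ n → n + 3 ≤ k + i → k ≤ n →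
      qint v 2 ^ 2 * A (n - k) i - qint v 2 ^ 2 * A (n - k + 1) i
        + A (n - k + 2) i = 0) := by
  have h2 : qint v 2 ≠ 0 := hgen 2 (by norm_num)
  have h3 : qint v 3 ≠ 0 := hgen 3 (by norm_num)
  have h4 : qint v 4 = qint v 2 * qsum v 2 := qint_two_mul hv 2
  have h6 : qint v 2 * qint v 6 / qint v 3 = qint v 2 * qsum v 3 := by
    rw [show qint v 6 = qint v 3 * qsum v 3 from qint_two_mul hv 3]
    field_simp
  have hn0 : qint v n ≠ 0 := hgen n (by omega)
  have hn1 : qint v (n + 1 : ℤ) ≠ 0 := hgen _ (by omega)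
  have hn2 : qint v (2 * n + 2 : ℤ) ≠ 0 := hgen _ (by omega)
  obtain ⟨C, hC⟩ : ∃ C, C = qint v (n + 1 : ℤ) / (qint v n * qint v (2 * n + 2 : ℤ)) := ⟨_, rfl⟩
  -- In terms of `q = n - j` and `m = n - i`, each coefficient is `C [2]^(q-m+1) [q+1] [2m+2]/[m+1]`.
  have hB : ∀ i j : ℕ, ∀ e q m : ℤ, i < j → j ≤ n → (i : ℤ) - j + 1 = e → (n : ℤ) - j + 1 = q →
      (n : ℤ) - i + 1 = m → A i j = C * qint v 2 ^ e * (qint v q * qsum v m) := by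
    rintro i j _ _ _ hij hj rfl rfl rfl
    have hm : qint v (n - i + 1 : ℤ) ≠ 0 := hgen _ (by omega)
    rw [hA i j hij hj, hC, show (2 * n - 2 * i + 2 : ℤ) = 2 * (n - i + 1) by ring,
      qint_two_mul hv]
    field_simp
  refine ⟨?_, ?_, ?_, ?_, ?_, ?_⟩
  · rw [hA 0 1 one_pos (by omega)]
    simp only [Nat.cast_zero, Nat.cast_one, mul_zero, sub_zero, sub_add_cancel, zero_sub,
      neg_add_cancel, zpow_zero, one_mul]
    field_simp
  · rw [h6, hB (n - 2) (n - 1) 0 2 3 (by omega) (by omega) (by omega) (by omega) (by omega),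
      hB (n - 2) n (-1) 1 3 (by omega) (by omega) (by omega) (by omega) (by omega),
      hB (n - 1) n 0 1 2 (by omega) (by omega) (by omega) (by omega) (by omega),
      qint_one hvv, zpow_neg_one, zpow_zero]
    have h := qsum_add_one_add_qsum_sub_one hv hvv 2
    have h1 : qsum v 1 = qint v 2 := by simp [qsum, qint_two hvv]
    norm_num [h1] at h
    field_simp
    linear_combination C * qsum v 3 * h
  · intro i _ hi
    obtain ⟨m, hm⟩ : ∃ m : ℤ, m = n - i + 1 := ⟨_, rfl⟩
    rw [h6, h4,
      hB i (i + 1) 0 (m - 1) m (by omega) (by omega) (by omega) (by omega) (by omega),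
      hB i (i + 2) (-1) (m - 2) m (by omega) (by omega) (by omega) (by omega) (by omega),
      hB i (i + 3) (-2) (m - 3) m (by omega) (by omega) (by omega) (by omega) (by omega),
      hB (i + 1) (i + 2) 0 (m - 2) (m - 1) (by omega) (by omega) (by omega) (by omega) (by omega),
      hB (i + 1) (i + 3) (-1) (m - 3) (m - 1)
        (by omega) (by omega) (by omega) (by omega) (by omega),
      hB (i + 2) (i + 3) 0 (m - 3) (m - 2) (by omega) (by omega) (by omega) (by omega) (by omega),
      zpow_neg_one, zpow_zero, zpow_neg, zpow_ofNat]
    have h := qint_qsum_six_term_relation hv hvv m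
    field_simp
    linear_combination C * h
  · intro i hi
    rw [hB i (n - 1) (i - n + 1 + 1) 2 (n - i + 1)
        (by omega) (by omega) (by omega) (by omega) (by omega),
      hB i n (i - n + 1) 1 (n - i + 1) (by omega) (by omega) (by omega) (by omega) (by omega),
      qint_one hvv, zpow_add_one₀ h2]
    ring
  · intro i k hi hk hki
    obtain ⟨e, he⟩ : ∃ e : ℤ, e = i - n + k - 1 := ⟨_, rfl⟩
    rw [hB i (n - k) (e + 1 + 1) (k + 1) (n - i + 1)
        (by omega) (by omega) (by omega) (by omega) (by omega),
      hB i (n - k + 1) (e + 1) k (n - i + 1)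
        (by omega) (by omega) (by omega) (by omega) (by omega),
      hB i (n - k + 2) e (k - 1) (n - i + 1)
        (by omega) (by omega) (by omega) (by omega) (by omega),
      zpow_add_one₀ h2, zpow_add_one₀ h2]
    linear_combination C * qint v 2 ^ e * qint v 2 ^ 2 * qsum v (n - i + 1) *
      qint_add_one_add_qint_sub_one hv hvv k
  · intro i k _ hi hki hk
    obtain ⟨e, he⟩ : ∃ e : ℤ, e = n - k - i + 1 := ⟨_, rfl⟩
    rw [hB (n - k) i e (n - i + 1) (k + 1)
        (by omega) (by omega) (by omega) (by omega) (by omega),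
      hB (n - k + 1) i (e + 1) (n - i + 1) k
        (by omega) (by omega) (by omega) (by omega) (by omega),
      hB (n - k + 2) i (e + 1 + 1) (n - i + 1) (k - 1)
        (by omega) (by omega) (by omega) (by omega) (by omega)]
    simp only [zpow_add_one₀ h2]
    linear_combination C * qint v 2 ^ e * qint v 2 ^ 2 * qint v (n - i + 1) *
      qsum_add_one_add_qsum_sub_one hv hvv k
end

section
/- For natural numbers i, j, k, assume v is generic and define F(i,j,k) = [i+j+k+2]!·[i+1]!·[j]!·[k+1]! / ([i+j]!·[j+k]!·[i+k+1]!·[2]). Then: (i) F(i,j,0) = [i+j+2]·[i+j+1]/[2]; and (ii) for all i ≥ 1 and k ≥ 1, F(i,j,k) = ([j+k+2]/[j+k])·F(i,j,k−1) − ([i+1]·[i]/([i+k+1]·[i+k]))·F(i−1,j+1,k−1). -/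
theorem qint_add_mul_qint_add {K : Type*} [Field K] (v : K) (hv : v ≠ 0) (a b x : ℤ) :
    qint v (b + x) * qint v (a + x) - qint v a * qint v b = qint v x * qint v (a + b + x) := by
  simp only [qint, div_mul_div_comm, ← sub_div]
  congr 1
  simp only [neg_add, zpow_add₀ hv, zpow_neg]
  have ha := zpow_ne_zero a hv
  have hb := zpow_ne_zero b hv
  have hx := zpow_ne_zero x hv
  field_simp
  ring

theorem qfact_succ {K : Type*} [Field K] (v : K) (n : ℕ) :
    qfact v (n + 1) = qint v (n + 1) * qfact v n := rfl

theorem qfact_ne_zero {K : Type*} [Field K] (v : K)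
    (hgen : ∀ m : ℤ, 1 ≤ m → qint v m ≠ 0) (n : ℕ) : qfact v n ≠ 0 := by
  induction n with
  | zero => exact one_ne_zero
  | succ n ih => exact mul_ne_zero (hgen _ (by omega)) ih

theorem stmt13 {K : Type*} [Field K] (v : K) (hv : v ≠ 0) (hvv : v - v⁻¹ ≠ 0)
    (hgen : ∀ m : ℤ, 1 ≤ m → qint v m ≠ 0)
    (F : ℕ → ℕ → ℕ → K)
    (hF : ∀ i j k : ℕ, F i j k =
      qfact v (i + j + k + 2) * qfact v (i + 1) * qfact v j * qfact v (k + 1) /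
        (qfact v (i + j) * qfact v (j + k) * qfact v (i + k + 1) * qint v 2)) :
    (∀ i j : ℕ, F i j 0 = qint v (i + j + 2 : ℤ) * qint v (i + j + 1 : ℤ) / qint v 2) ∧
    (∀ i j k : ℕ, 1 ≤ i → 1 ≤ k →
      F i j k = (qint v (j + k + 2 : ℤ) / qint v (j + k : ℤ)) * F i j (k - 1) -
        (qint v (i + 1 : ℤ) * qint v i / (qint v (i + k + 1 : ℤ) * qint v (i + k : ℤ))) *
          F (i - 1) (j + 1) (k - 1)) := by
  have hq := qfact_ne_zero v hgen
  have h2 := hgen 2 (by norm_num)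
  refine ⟨fun i j => ?_, fun i j k hi hk => ?_⟩
  · have e : qfact v (i + j + 0 + 2) =
        qint v (i + j + 2 : ℤ) * (qint v (i + j + 1 : ℤ) * qfact v (i + j)) := by
      rw [add_zero, qfact_succ, qfact_succ]
      push_cast
      ring_nf
    have e1 : qfact v (0 + 1) = qint v 1 := by simp [qfact]
    have h1 : qint v 1 = 1 := by
      simp only [qint, zpow_one, zpow_neg]
      exact div_self hvv
    rw [hF, e, e1, h1]
    simp only [add_zero]
    have := hq (i + j)
    have := hq j
    have := hq (i + 1)
    field_simp
  · obtain ⟨a, rfl⟩ := Nat.exists_eq_add_of_le' hi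
    obtain ⟨b, rfl⟩ := Nat.exists_eq_add_of_le' hk
    have key := qint_add_mul_qint_add v hv (a + 1) (j + 1) (b + 2)
    have top : qfact v (a + 1 + j + (b + 1) + 2) =
        qint v (a + 1 + (j + 1) + (b + 2) : ℤ) * qfact v (a + j + b + 3) := by
      rw [show a + 1 + j + (b + 1) + 2 = a + j + b + 3 + 1 by ring, qfact_succ]
      push_cast
      ring_nf
    have ea : qfact v (a + 2) = qint v (a + 2 : ℤ) * qfact v (a + 1) := by
      rw [qfact_succ]
      push_cast
      ring_nf
    have eb : qfact v (b + 2) = qint v (b + 2 : ℤ) * qfact v (b + 1) := by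
      rw [qfact_succ]
      push_cast
      ring_nf
    have ej : qfact v (j + 1) = qint v (j + 1 : ℤ) * qfact v j := qfact_succ v j
    have ejb : qfact v (j + b + 1) = qint v (j + b + 1 : ℤ) * qfact v (j + b) := by
      rw [qfact_succ]
      push_cast
      ring_nf
    have eab : qfact v (a + b + 3) =
        qint v (a + 1 + (b + 2) : ℤ) * (qint v (a + b + 2 : ℤ) * qfact v (a + b + 1)) := by
      rw [qfact_succ, qfact_succ]
      push_cast
      ring_nf
    have eab2 : qfact v (a + b + 2) = qint v (a + b + 2 : ℤ) * qfact v (a + b + 1) := by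
      rw [qfact_succ]
      push_cast
      ring_nf
    rw [hF, hF, hF, top]
    simp only [Nat.add_sub_cancel]
    rw [show a + 1 + 1 = a + 2 by ring, show b + 1 + 1 = b + 2 by ring,
      show j + (b + 1) = j + b + 1 by ring, show a + 1 + (b + 1) + 1 = a + b + 3 by ring,
      show a + 1 + j + b + 2 = a + j + b + 3 by ring,
      show a + 1 + b + 1 = a + b + 2 by ring,
      show a + (j + 1) + b + 2 = a + j + b + 3 by ring,
      show a + (j + 1) = a + 1 + j by ring, show j + 1 + b = j + b + 1 by ring,
      ea, eb, ej, ejb, eab, eab2]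
    push_cast
    rw [show (j + (b + 1) + 2 : ℤ) = j + 1 + (b + 2) by ring,
      show (j + (b + 1) : ℤ) = j + b + 1 by ring,
      show (a + 1 + 1 : ℤ) = a + 2 by ring,
      show (a + 1 + (b + 1) + 1 : ℤ) = a + 1 + (b + 2) by ring,
      show (a + 1 + (b + 1) : ℤ) = a + b + 2 by ring]
    have := hq (a + 1 + j)
    have := hq (j + b)
    have := hq (a + b + 1)
    have := hgen (j + b + 1) (by omega)
    have := hgen (a + 1 + (b + 2)) (by omega)
    have := hgen (a + b + 2) (by omega)
    field_simp
    linear_combination (-(qfact v (a + j + b + 3) * qint v (a + 2 : ℤ) * qfact v (a + 1) *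
      qfact v j * qfact v (b + 1))) * key
end
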